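/- arXiv:gr-qc/0609100 — 10 statements merged into one kernel-verified Lean document; each statement's English description precedes it below -/
import Mathlib

section
/- Let E be a real symmetric 3×3 matrix with zero trace. Then for all indices λ, ν, μ, ρ ∈ {1,2,3} the following identity holds (all repeated indices σ, α summed over {1,2,3}): (1/2)(E_{λν}E_{μρ} − E_{λμ}E_{νρ}) + (1/2)(E_{ρσ}E_{μσ}h_{νλ} − E_{ρσ}E_{νσ}h_{μλ}) + (1/2)(E_{λσ}E_{σν}h_{μρ} − E_{λσ}E_{σμ}h_{νρ}) + (1/4)(Σ_{σ,α} E_{σα}E_{σα})(h_{λμ}h_{νρ} − h_{λν}h_{μρ}) = 0. -/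
/-- The Euclidean metric on `ℝ³` (the identity matrix). -/
def h3 (i j : Fin 3) : ℝ := if i = j then 1 else 0

/-- Lemma 1 of the paper: the 3+1 form of the dimensionally dependent Weyl
identity (equation (long)) holds identically for any symmetric traceless `E`. -/
theorem stmt0 (E : Matrix (Fin 3) (Fin 3) ℝ)
    (hsym : E.IsSymm) (htr : E.trace = 0) :
    ∀ l n m r : Fin 3,
      (1/2) * (E l n * E m r - E l m * E n r)
      + (1/2) * ((∑ s, E r s * E m s) * h3 n l - (∑ s, E r s * E n s) * h3 m l)
      + (1/2) * ((∑ s, E l s * E s n) * h3 m r - (∑ s, E l s * E s m) * h3 n r)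
      + (1/4) * (∑ s, ∑ a, E s a * E s a) * (h3 l m * h3 n r - h3 l n * h3 m r)
      = 0 := by
  have h10 : E 1 0 = E 0 1 := hsym.apply 0 1
  have h20 : E 2 0 = E 0 2 := hsym.apply 0 2
  have h21 : E 2 1 = E 1 2 := hsym.apply 1 2
  have h22 : E 2 2 = -E 0 0 - E 1 1 := by
    rw [Matrix.trace_fin_three] at htr
    linarith
  intro l n m r
  fin_cases l <;> fin_cases n <;> fin_cases m <;> fin_cases r <;>
    simp [h3, Fin.sum_univ_three, h10, h20, h21, h22] <;> ring
end

section
/- Let E and B be real symmetric 3×3 matrices with zero trace and ρ a nonzero real scalar satisfying (rule1) ρB = −(BE+EB) and (rule2) ρE = B² − E² + 2ρ²I. Then for all indices μ, ν, λ, δ ∈ {1,2,3} the equation (easy-1) holds: 2(E_{μδ}E_{λν} − E_{μλ}E_{δν}) + [h_{νλ}(Σ_π B_{δπ}B_{μπ} + Σ_π E_{δπ}E_{μπ} − ρE_{δμ}) − h_{νδ}(Σ_π B_{λπ}B_{μπ} + Σ_π E_{λπ}E_{μπ} − ρE_{λμ})] + [h_{μδ}(Σ_π B_{λπ}B_{νπ}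 + Σ_π E_{λπ}E_{νπ} − ρE_{λν}) − h_{μλ}(Σ_π B_{δπ}B_{νπ} + Σ_π E_{δπ}E_{νπ} − ρE_{δν})] + (h_{μλ}h_{δν} − h_{μδ}h_{λν})(Σ_{π,κ} B_{πκ}B_{πκ} + 2ρ²) = 0. -/
/-- In dimension three a traceless symmetric matrix `E` satisfies the identity expressing its
second compound matrix through `E * E` and the trace of `E * E`. -/
theorem compound_identity_of_trace_eq_zero (E : Matrix (Fin 3) (Fin 3) ℝ) (hsym : E.IsSymm)
    (htr : E.trace = 0) (μ ν lam δ : Fin 3) :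
    2 * (E μ δ * E lam ν - E μ lam * E δ ν)
      + 2 * (h3 ν lam * (E * E) δ μ - h3 ν δ * (E * E) lam μ)
      + 2 * (h3 μ δ * (E * E) lam ν - h3 μ lam * (E * E) δ ν)
      + (h3 μ lam * h3 δ ν - h3 μ δ * h3 lam ν) * (E * E).trace = 0 := by
  have h10 : E 1 0 = E 0 1 := hsym.apply 0 1
  have h20 : E 2 0 = E 0 2 := hsym.apply 0 2
  have h21 : E 2 1 = E 1 2 := hsym.apply 1 2
  have h22 : E 2 2 = -E 0 0 - E 1 1 := by
    rw [Matrix.trace_fin_three] at htr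
    linarith
  simp only [Matrix.trace_fin_three, Matrix.mul_apply, Fin.sum_univ_three]
  fin_cases μ <;> fin_cases ν <;> fin_cases lam <;> fin_cases δ <;>
    simp [h3, h10, h20, h21, h22] <;> ring

/-- The rows of a symmetric matrix have pairwise products given by its square. -/
theorem sum_mul_eq_mul_self_apply (M : Matrix (Fin 3) (Fin 3) ℝ) (hsym : M.IsSymm)
    (i j : Fin 3) : ∑ k, M i k * M j k = (M * M) i j := by
  rw [Matrix.mul_apply]
  exact Finset.sum_congr rfl fun k _ => by rw [hsym.apply k j]

/-- If the symmetric traceless matrices `E` and `B` and the nonzero scalar `ρ`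
satisfy (rule1) `ρB = −(BE+EB)` and (rule2) `ρE = B² − E² + 2ρ²I`, then
equation (easy-1) of the 3+1 split of the Ferrando–Sáez condition holds. -/
theorem stmt1 (E B : Matrix (Fin 3) (Fin 3) ℝ) (ρ : ℝ) (hρ : ρ ≠ 0)
    (hsymE : E.IsSymm) (hsymB : B.IsSymm)
    (htrE : E.trace = 0) (htrB : B.trace = 0)
    (rule1 : ρ • B = -(B * E + E * B))
    (rule2 : ρ • E = B * B - E * E + (2 * ρ^2) • (1 : Matrix (Fin 3) (Fin 3) ℝ)) :
    ∀ μ ν lam δ : Fin 3,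
      2 * (E μ δ * E lam ν - E μ lam * E δ ν)
      + (h3 ν lam * ((∑ π, B δ π * B μ π) + (∑ π, E δ π * E μ π) - ρ * E δ μ)
         - h3 ν δ * ((∑ π, B lam π * B μ π) + (∑ π, E lam π * E μ π) - ρ * E lam μ))
      + (h3 μ δ * ((∑ π, B lam π * B ν π) + (∑ π, E lam π * E ν π) - ρ * E lam ν)
         - h3 μ lam * ((∑ π, B δ π * B ν π) + (∑ π, E δ π * E ν π) - ρ * E δ ν))
      + (h3 μ lam * h3 δ ν - h3 μ δ * h3 lam ν) * ((∑ π, ∑ κ, B π κ * B π κ) + 2 * ρ^2)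
      = 0 := by
  intro μ ν lam δ
  have hentry (i j : Fin 3) :
      ρ * E i j = (B * B) i j - (E * E) i j + 2 * ρ ^ 2 * h3 i j := by
    simpa [h3, Matrix.one_apply] using congrFun (congrFun rule2 i) j
  have htrace : (B * B).trace = (E * E).trace - 6 * ρ ^ 2 := by
    have h := congrArg Matrix.trace rule2
    simp only [Matrix.trace_smul, Matrix.trace_add, Matrix.trace_sub, htrE, Matrix.trace_one,
      Fintype.card_fin, smul_eq_mul] at h
    push_cast at h
    linarith
  have hnorm : ∑ π, ∑ κ, B π κ * B π κ = (B * B).trace :=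
    Finset.sum_congr rfl fun i _ => sum_mul_eq_mul_self_apply B hsymB i i
  have hcomm (i j : Fin 3) : h3 i j = h3 j i := by simp only [h3, eq_comm]
  rw [hnorm, htrace]
  simp only [sum_mul_eq_mul_self_apply E hsymE,
    sum_mul_eq_mul_self_apply B hsymB, hentry]
  rw [hcomm ν lam, hcomm ν δ, hcomm δ μ, hcomm lam μ]
  have h := compound_identity_of_trace_eq_zero E hsymE htrE μ ν lam δ
  rw [hcomm ν lam, hcomm ν δ] at h
  linear_combination h
end

section
/- Let E and B be real symmetric 3×3 matrices with zero trace and ρ a nonzero real scalar. Then the following two systems of equations are equivalent. System 1: for all ν, λ, δ ∈ {1,2,3}: Σ_{σ,α}[B_{νσ}E_{δα}ε_{λσα} + B_{σα}E_{νσ}ε_{λδα} − B_{νσ}E_{λα}ε_{δσα}] + ρΣ_σ B_{νσ}ε_{λδσ} = 0 (equation (easy-2)), together with, for all μ, λ ∈ {1,2,3}: Σ_α E_{λα}E_{μα} − Σ_α B_{λα}B_{μα} + ρ(E_{μλ} − 2ρh_{μλ}) = 0 (equation (easy-3)). System 2: ρB = −(BE+EB) (rule1) together with ρE = B² − E² +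 2ρ²I (rule2). -/
/-- The alternating Levi-Civita symbol on three indices, with `eps3 0 1 2 = 1`. -/
noncomputable def eps3 (i j k : Fin 3) : ℝ :=
  (((j : ℕ) : ℝ) - ((i : ℕ) : ℝ)) * (((k : ℕ) : ℝ) - ((i : ℕ) : ℝ))
    * (((k : ℕ) : ℝ) - ((j : ℕ) : ℝ)) / 2

/-- For trace-free `E`, these contractions of `B` and `E` combine to the contraction of
`B * E + E * B + ρ • B` with the Levi-Civita symbol. -/
lemma eps3_contractions_eq_sum_eps3_mul (E B : Matrix (Fin 3) (Fin 3) ℝ) (ρ : ℝ) (htrE : E.trace = 0)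
    (ν lam δ : Fin 3) :
    (∑ σ, ∑ a, (B ν σ * E δ a * eps3 lam σ a + B σ a * E ν σ * eps3 lam δ a
        - B ν σ * E lam a * eps3 δ σ a)) + ρ * (∑ σ, B ν σ * eps3 lam δ σ)
      = ∑ κ, eps3 lam δ κ * (B * E + E * B + ρ • B) ν κ := by
  rw [Matrix.trace_fin_three] at htrE
  have hE : E 2 2 = -E 0 0 - E 1 1 := by linarith
  fin_cases lam <;> fin_cases δ <;>
    simp [Fin.sum_univ_three, eps3, Matrix.mul_apply, hE] <;> ring

/-- Contraction with the Levi-Civita symbol is injective. -/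
lemma sum_eps3_mul_eq_zero_iff (M : Matrix (Fin 3) (Fin 3) ℝ) :
    (∀ ν lam δ : Fin 3, ∑ κ, eps3 lam δ κ * M ν κ = 0) ↔ M = 0 := by
  refine ⟨fun h => ?_, fun h => by simp [h]⟩
  ext ν κ
  have h0 := h ν 1 2
  have h1 := h ν 2 0
  have h2 := h ν 0 1
  norm_num [Fin.sum_univ_three, eps3] at h0 h1 h2
  fin_cases κ <;> simpa

/-- Equivalence of the system {(easy-2), (easy-3)} with the system
{(rule1), (rule2)} for symmetric traceless `E`, `B` and nonzero scalar `ρ`. -/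
theorem stmt2 (E B : Matrix (Fin 3) (Fin 3) ℝ) (ρ : ℝ) (hρ : ρ ≠ 0)
    (hsymE : E.IsSymm) (hsymB : B.IsSymm)
    (htrE : E.trace = 0) (htrB : B.trace = 0) :
    ((∀ ν lam δ : Fin 3,
        (∑ σ, ∑ a, (B ν σ * E δ a * eps3 lam σ a + B σ a * E ν σ * eps3 lam δ a
          - B ν σ * E lam a * eps3 δ σ a))
        + ρ * (∑ σ, B ν σ * eps3 lam δ σ) = 0)
      ∧ (∀ μ lam : Fin 3,
          (∑ a, E lam a * E μ a) - (∑ a, B lam a * B μ a)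
          + ρ * (E μ lam - 2 * ρ * h3 μ lam) = 0))
    ↔ (ρ • B = -(B * E + E * B)
        ∧ ρ • E = B * B - E * E + (2 * ρ^2) • (1 : Matrix (Fin 3) (Fin 3) ℝ)) := by
  refine and_congr ?_ ?_
  · simp_rw [eps3_contractions_eq_sum_eps3_mul E B ρ htrE]
    rw [sum_eps3_mul_eq_zero_iff, eq_neg_iff_add_eq_zero, add_comm]
  · rw [← Matrix.ext_iff]
    refine forall₂_congr fun μ lam => ?_
    have hE : ∑ a, E lam a * E μ a = (E * E) μ lam := by
      simp only [Matrix.mul_apply, hsymE.apply lam, mul_comm]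
    have hB : ∑ a, B lam a * B μ a = (B * B) μ lam := by
      simp only [Matrix.mul_apply, hsymB.apply lam, mul_comm]
    rw [hE, hB]
    simp only [h3, Matrix.add_apply, Matrix.sub_apply, Matrix.smul_apply, Matrix.one_apply,
      smul_eq_mul]
    constructor <;> intro h <;> linear_combination h
end

section
/- Let E and B be real symmetric 3×3 matrices with zero trace and ρ a real scalar satisfying both ρB = −(BE+EB) (rule1) and ρE = B² − E² + 2ρ²I (rule2). Then ρ³ = (1/2)tr(B²E) − (1/6)tr(E³), i.e. ρ³ = (1/2)Σ B_{ij}B_{jk}E_{ki} − (1/6)Σ E_{ij}E_{jk}E_{ki}. -/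
/-- The trace of a triple product, written in components. -/
theorem Matrix.trace_mul_mul_eq_sum {n R : Type*} [Fintype n] [NonUnitalSemiring R]
    (A B C : Matrix n n R) :
    (A * B * C).trace = ∑ i, ∑ j, ∑ k, A i j * B j k * C k i := by
  simp only [Matrix.trace, Matrix.diag_apply, Matrix.mul_apply, Finset.sum_mul]
  exact Finset.sum_congr rfl fun i _ => Finset.sum_comm

/-- Consistency of the two formulas for the Weyl scalar `ρ`:
under (rule1) and (rule2), `ρ³ = (1/2)tr(B²E) − (1/6)tr(E³)`. -/
theorem stmt5 (E B : Matrix (Fin 3) (Fin 3) ℝ) (ρ : ℝ)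
    (hsymE : E.IsSymm) (hsymB : B.IsSymm)
    (htrE : E.trace = 0) (htrB : B.trace = 0)
    (rule1 : ρ • B = -(B * E + E * B))
    (rule2 : ρ • E = B * B - E * E + (2 * ρ^2) • (1 : Matrix (Fin 3) (Fin 3) ℝ)) :
    ρ^3 = (1/2) * (∑ i, ∑ j, ∑ k, B i j * B j k * E k i)
          - (1/6) * (∑ i, ∑ j, ∑ k, E i j * E j k * E k i) := by
  rw [← Matrix.trace_mul_mul_eq_sum, ← Matrix.trace_mul_mul_eq_sum]
  have tr_rule2 := congrArg Matrix.trace rule2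
  have tr_rule1_mul := congrArg (fun M => (M * B).trace) rule1
  have tr_rule2_mul := congrArg (fun M => (M * E).trace) rule2
  have cycle₁ : (B * E * B).trace = (B * B * E).trace := Matrix.trace_mul_cycle B E B
  have cycle₂ : (E * B * B).trace = (B * B * E).trace := by
    rw [Matrix.trace_mul_cycle, Matrix.trace_mul_cycle]
  simp only [Matrix.add_mul, Matrix.sub_mul, Matrix.neg_mul, Matrix.smul_mul, Matrix.one_mul,
    Matrix.trace_add, Matrix.trace_sub, Matrix.trace_neg, Matrix.trace_smul, Matrix.trace_one,
    smul_eq_mul, Fintype.card_fin, htrE, cycle₁, cycle₂]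
    at tr_rule2 tr_rule1_mul tr_rule2_mul
  push_cast at tr_rule2
  linear_combination (-ρ / 6) * tr_rule2 - (1 / 6) * tr_rule1_mul + (1 / 6) * tr_rule2_mul
end

section
/- In ℝ⁴ with the Minkowski metric η = diag(−1,1,1,1), let E and B be symmetric traceless spatial tensors, let n = e₀, and let C be the 4-index tensor built from E and B by the electric–magnetic decomposition formula (weyl-1). Then tr(C⋆C⋆C) = 6·tr(B²E) − 2·tr(E³), where (C⋆C⋆C)_{μνλψ} = (1/4)C_{μν}^{στ}C_{στ}^{κπ}C_{κπλψ}, tr U = (1/2)U^{μν}_{μν} (indices raised with η), and the right-hand side traces are ordinary 3×3 matrix traces of the spatial blocks of B and E. -/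
/-- The diagonal entries of the Minkowski metric `η = diag(−1,1,1,1)`
(equal to those of its inverse). -/
def dd (μ : Fin 4) : ℝ := if μ = 0 then -1 else 1

/-- The Minkowski metric `η = diag(−1,1,1,1)`. -/
def eta (μ ν : Fin 4) : ℝ := if μ = ν then dd μ else 0

/-- The unit timelike vector `n = e₀` (upper index). -/
def nUp (μ : Fin 4) : ℝ := if μ = 0 then 1 else 0

/-- The lower-index version `n_μ = η_{μν}n^ν = (−1,0,0,0)`. -/
def nDown (μ : Fin 4) : ℝ := if μ = 0 then -1 else 0

/-- `l_{μν} = η_{μν} + 2 n_μ n_ν`. -/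
def lD (μ ν : Fin 4) : ℝ := eta μ ν + 2 * nDown μ * nDown ν

/-- The 4-dimensional alternating symbol with `eps4 0 1 2 3 = 1`. -/
noncomputable def eps4 (a b c d : Fin 4) : ℝ :=
  ((((b : ℕ) : ℝ) - ((a : ℕ) : ℝ)) * (((c : ℕ) : ℝ) - ((a : ℕ) : ℝ))
    * (((d : ℕ) : ℝ) - ((a : ℕ) : ℝ)) * (((c : ℕ) : ℝ) - ((b : ℕ) : ℝ))
    * (((d : ℕ) : ℝ) - ((b : ℕ) : ℝ)) * (((d : ℕ) : ℝ) - ((c : ℕ) : ℝ))) / 12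

/-- `ε^τ_{λσ} = ε_{ντλσ}n^ν` with the index `τ` raised by `η`
(which equals `ε_{0τλσ}`). -/
noncomputable def eps3of4 (τ lam σ : Fin 4) : ℝ := eps4 0 τ lam σ

/-- The Weyl tensor built from its electric and magnetic parts, formula (weyl-1):
`C_{μνλσ} = 2( l_{μ[λ}E_{σ]ν} − l_{ν[λ}E_{σ]μ} − n_{[λ}B_{σ]τ}ε^τ_{μν} − n_{[μ}B_{ν]τ}ε^τ_{λσ} )`. -/
noncomputable def weylC (E B : Fin 4 → Fin 4 → ℝ) (μ ν lam σ : Fin 4) : ℝ :=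
  2 * ((1/2) * (lD μ lam * E σ ν - lD μ σ * E lam ν)
    - (1/2) * (lD ν lam * E σ μ - lD ν σ * E lam μ)
    - (1/2) * (∑ τ, (nDown lam * B σ τ - nDown σ * B lam τ) * eps3of4 τ μ ν)
    - (1/2) * (∑ τ, (nDown μ * B ν τ - nDown ν * B μ τ) * eps3of4 τ lam σ))

/-- A sum over ordered index pairs of a symmetric function vanishing on the diagonal is twice the
sum over the three pairs `0i` and the three cyclic spatial pairs. -/
theorem sum_sum_eq_two_mul_sum_pairs (f : Fin 4 → Fin 4 → ℝ) (hf : ∀ a b, f a b = f b a)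
    (hd : ∀ a, f a a = 0) :
    ∑ a, ∑ b, f a b = 2 * ∑ i : Fin 3, (f 0 i.succ + f (i + 1).succ (i + 2).succ) := by
  have h1 : (1 + 1 : Fin 3) = 2 := rfl
  have h2 : (1 + 2 : Fin 3) = 0 := rfl
  have h3 : (2 + 1 : Fin 3) = 0 := rfl
  have h4 : (2 + 2 : Fin 3) = 1 := rfl
  have e0 : (0 : Fin 3).succ = 1 := rfl
  have e1 : (1 : Fin 3).succ = 2 := rfl
  have e2 : (2 : Fin 3).succ = 3 := rfl
  simp only [Fin.sum_univ_four, Fin.sum_univ_three, hd, zero_add, h1, h2, h3, h4, e0, e1, e2]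
  rw [hf 1 0, hf 2 0, hf 3 0, hf 2 1, hf 3 2, hf 1 3]
  ring

theorem weylC_swap_left (E B : Fin 4 → Fin 4 → ℝ) (a b c d : Fin 4) :
    weylC E B b a c d = -weylC E B a b c d := by
  simp only [weylC, eps3of4, eps4, Fin.sum_univ_four]
  ring

theorem weylC_swap_right (E B : Fin 4 → Fin 4 → ℝ) (a b c d : Fin 4) :
    weylC E B a b d c = -weylC E B a b c d := by
  simp only [weylC, eps3of4, eps4, Fin.sum_univ_four]
  ring

theorem weylC_self_left (E B : Fin 4 → Fin 4 → ℝ) (a c d : Fin 4) :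
    weylC E B a a c d = 0 := by
  linarith [weylC_swap_left E B a a c d]

theorem weylC_self_right (E B : Fin 4 → Fin 4 → ℝ) (a b c : Fin 4) :
    weylC E B a b c c = 0 := by
  linarith [weylC_swap_right E B a b c c]

section Components

variable {E B : Fin 4 → Fin 4 → ℝ}

theorem weylC_electric_electric
    (hsymE : ∀ μ ν, E μ ν = E ν μ) (hspE : ∀ μ ν, μ = 0 ∨ ν = 0 → E μ ν = 0) (i j : Fin 3) :
    weylC E B 0 i.succ 0 j.succ = E i.succ j.succ := by
  have h0 : ∀ μ, E 0 μ = 0 := fun μ => hspE 0 μ (Or.inl rfl)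
  have h0' : ∀ μ, E μ 0 = 0 := fun μ => hspE μ 0 (Or.inr rfl)
  rw [hsymE]
  simp [weylC, eps3of4, eps4, lD, eta, dd, nDown, h0, h0', Fin.succ_ne_zero]
  ring

theorem weylC_electric_magnetic
    (hspE : ∀ μ ν, μ = 0 ∨ ν = 0 → E μ ν = 0)
    (hspB : ∀ μ ν, μ = 0 ∨ ν = 0 → B μ ν = 0) (i j : Fin 3) :
    weylC E B 0 i.succ (j + 1).succ (j + 2).succ = B i.succ j.succ := by
  have h0' : ∀ μ, E μ 0 = 0 := fun μ => hspE μ 0 (Or.inr rfl)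
  have k0 : ∀ μ, B 0 μ = 0 := fun μ => hspB 0 μ (Or.inl rfl)
  fin_cases j <;>
    simp [weylC, eps3of4, eps4, lD, eta, dd, nDown, h0', k0, Fin.succ_ne_zero,
      Fin.sum_univ_four] <;> norm_num

theorem weylC_magnetic_electric
    (hspE : ∀ μ ν, μ = 0 ∨ ν = 0 → E μ ν = 0)
    (hspB : ∀ μ ν, μ = 0 ∨ ν = 0 → B μ ν = 0) (hsymB : ∀ μ ν, B μ ν = B ν μ) (i j : Fin 3) :
    weylC E B (i + 1).succ (i + 2).succ 0 j.succ = B i.succ j.succ := by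
  have h0 : ∀ μ, E 0 μ = 0 := fun μ => hspE 0 μ (Or.inl rfl)
  have k0 : ∀ μ, B 0 μ = 0 := fun μ => hspB 0 μ (Or.inl rfl)
  rw [hsymB]
  fin_cases i <;>
    simp [weylC, eps3of4, eps4, lD, eta, dd, nDown, h0, k0, Fin.succ_ne_zero,
      Fin.sum_univ_four] <;> norm_num

theorem weylC_magnetic_magnetic
    (hsymE : ∀ μ ν, E μ ν = E ν μ) (hspE : ∀ μ ν, μ = 0 ∨ ν = 0 → E μ ν = 0)
    (htrE : ∑ μ, E μ μ = 0) (i j : Fin 3) :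
    weylC E B (i + 1).succ (i + 2).succ (j + 1).succ (j + 2).succ = -E i.succ j.succ := by
  have h3 : E 3 3 = -E 1 1 - E 2 2 := by
    rw [Fin.sum_univ_four, hspE 0 0 (Or.inl rfl)] at htrE
    linarith
  fin_cases i <;> fin_cases j <;>
    simp [weylC, lD, eta, dd, nDown, h3, hsymE 2 1, hsymE 3 1, hsymE 3 2] <;> ring

end Components

/-- Formula (trCCC): `tr(C⋆C⋆C) = 6 tr(B²E) − 2 tr(E³)`, where
`tr(C⋆C⋆C) = (1/8) C^{αβστ}C_{στ}^{κπ}C_{κπαβ}` with indices raised by `η`. -/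
theorem stmt6 (E B : Fin 4 → Fin 4 → ℝ)
    (hsymE : ∀ μ ν, E μ ν = E ν μ) (hsymB : ∀ μ ν, B μ ν = B ν μ)
    (hspE : ∀ μ ν, μ = 0 ∨ ν = 0 → E μ ν = 0)
    (hspB : ∀ μ ν, μ = 0 ∨ ν = 0 → B μ ν = 0)
    (htrE : ∑ μ, E μ μ = 0) (htrB : ∑ μ, B μ μ = 0) :
    (1/2) * ∑ α, ∑ β, ∑ σ, ∑ τ, ∑ κ, ∑ π,
        dd α * dd β * dd σ * dd τ * dd κ * dd π * ((1/4)
          * weylC E B α β σ τ * weylC E B σ τ κ π * weylC E B κ π α β)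
      = 6 * (∑ μ, ∑ ν, ∑ lam, B μ ν * B ν lam * E lam μ)
        - 2 * (∑ μ, ∑ ν, ∑ lam, E μ ν * E ν lam * E lam μ) := by
  have key : ∀ f : Fin 4 → Fin 4 → Fin 4 → Fin 4 → Fin 4 → Fin 4 → ℝ,
      f = (fun α β σ τ κ π => dd α * dd β * dd σ * dd τ * dd κ * dd π * ((1/4)
          * weylC E B α β σ τ * weylC E B σ τ κ π * weylC E B κ π α β)) →
      ∑ α, ∑ β, ∑ σ, ∑ τ, ∑ κ, ∑ π, f α β σ τ κ π =
      2 * ∑ i : Fin 3, (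
        (2 * ∑ j : Fin 3, (
          (2 * ∑ k : Fin 3, (f 0 i.succ 0 j.succ 0 k.succ
            + f 0 i.succ 0 j.succ (k + 1).succ (k + 2).succ))
          + (2 * ∑ k : Fin 3, (f 0 i.succ (j + 1).succ (j + 2).succ 0 k.succ
            + f 0 i.succ (j + 1).succ (j + 2).succ (k + 1).succ (k + 2).succ))))
        + (2 * ∑ j : Fin 3, (
          (2 * ∑ k : Fin 3, (f (i + 1).succ (i + 2).succ 0 j.succ 0 k.succ
            + f (i + 1).succ (i + 2).succ 0 j.succ (k + 1).succ (k + 2).succ))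
          + (2 * ∑ k : Fin 3, (f (i + 1).succ (i + 2).succ (j + 1).succ (j + 2).succ 0 k.succ
            + f (i + 1).succ (i + 2).succ (j + 1).succ (j + 2).succ
                (k + 1).succ (k + 2).succ))))) := by
    intro f hf
    have sκ : ∀ α β σ τ κ π, f α β σ τ κ π = f α β σ τ π κ := by
      intro α β σ τ κ π
      simp only [hf]
      rw [weylC_swap_right E B σ τ π κ, weylC_swap_left E B π κ α β]
      ring
    have sσ : ∀ α β σ τ κ π, f α β σ τ κ π = f α β τ σ κ π := by
      intro α β σ τ κ π
      simp only [hf]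
      rw [weylC_swap_right E B α β τ σ, weylC_swap_left E B τ σ κ π]
      ring
    have sα : ∀ α β σ τ κ π, f α β σ τ κ π = f β α σ τ κ π := by
      intro α β σ τ κ π
      simp only [hf]
      rw [weylC_swap_right E B κ π β α, weylC_swap_left E B β α σ τ]
      ring
    have dκ : ∀ α β σ τ κ, f α β σ τ κ κ = 0 := by
      intros; simp [hf, weylC_self_left]
    have dσ : ∀ α β σ κ π, f α β σ σ κ π = 0 := by
      intros; simp [hf, weylC_self_left]
    have dα : ∀ α σ τ κ π, f α α σ τ κ π = 0 := by
      intros; simp [hf, weylC_self_left]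
    have hκ : ∀ α β σ τ, _ := fun α β σ τ =>
      sum_sum_eq_two_mul_sum_pairs (f α β σ τ) (sκ α β σ τ) (dκ α β σ τ)
    have hσ : ∀ α β, _ := fun α β =>
      sum_sum_eq_two_mul_sum_pairs (fun σ τ => ∑ κ, ∑ π, f α β σ τ κ π)
        (fun σ τ => by simp only [sσ α β σ τ]) (fun σ => by simp only [dσ, Finset.sum_const_zero])
    have hα := sum_sum_eq_two_mul_sum_pairs (fun α β => ∑ σ, ∑ τ, ∑ κ, ∑ π, f α β σ τ κ π)
        (fun α β => by simp only [sα α β]) (fun α => by simp only [dα, Finset.sum_const_zero])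
    rw [hα]
    simp only [hσ]
    simp only [hκ]
  rw [key _ rfl]
  have d0 : dd 0 = -1 := by simp [dd]
  have ds : ∀ i : Fin 3, dd i.succ = 1 := fun i => by simp [dd, Fin.succ_ne_zero]
  have h0 : ∀ μ, E 0 μ = 0 := fun μ => hspE 0 μ (Or.inl rfl)
  have h0' : ∀ μ, E μ 0 = 0 := fun μ => hspE μ 0 (Or.inr rfl)
  have k0 : ∀ μ, B 0 μ = 0 := fun μ => hspB 0 μ (Or.inl rfl)
  have k0' : ∀ μ, B μ 0 = 0 := fun μ => hspB μ 0 (Or.inr rfl)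
  simp only [d0, ds, weylC_electric_electric hsymE hspE, weylC_electric_magnetic hspE hspB,
    weylC_magnetic_electric hspE hspB hsymB, weylC_magnetic_magnetic hsymE hspE htrE]
  simp only [Fin.sum_univ_succ (n := 3), h0, h0', k0, k0', mul_zero, zero_mul, zero_add,
    Finset.sum_const_zero]
  simp only [Fin.sum_univ_three]
  ring
end

section
/- In ℝ⁴ with the Minkowski metric η = diag(−1,1,1,1), let E and B be symmetric traceless spatial tensors, n = e₀, and let C* be the 4-index tensor built from E and B by formula (weyl-2). Let P₀ ∈ ℝ, let P be a spatial vector (P⁰ = 0), and set v^μ := P₀n^μ + P^μ, Ẽ_μ := E_{μν}P^ν, B̃_μ := B_{μν}P^ν, γ² := P_νP^ν. Then for all μ, ν: C*_{λμσν}v^λv^σ = (P₀² + γ²)B_{μν} + 2P₀n_{(μ}B̃_{ν)} + 2P₀E_{τ(μ}ε^τ_{ν)λ}P^λ − 2P_{(μ}B̃_{ν)} + l_{μν}(B̃_σP^σ) − 2n_{(μ}Ẽ_{|τ|}ε^τ_{|σ|ν)}P^σ, where round brackets denote symmetrization X_{(μν)} = (1/2)(X_{μν} + X_{νμ}). -/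
/-- The dual Weyl tensor built from the electric and magnetic parts, formula (weyl-2):
`C*_{μνλσ} = 2( l_{μ[λ}B_{σ]ν} − l_{ν[λ}B_{σ]μ} + n_{[λ}E_{σ]τ}ε^τ_{μν} + n_{[μ}E_{ν]τ}ε^τ_{λσ} )`. -/
noncomputable def weylCStar (E B : Fin 4 → Fin 4 → ℝ) (μ ν lam σ : Fin 4) : ℝ :=
  2 * ((1/2) * (lD μ lam * B σ ν - lD μ σ * B lam ν)
    - (1/2) * (lD ν lam * B σ μ - lD ν σ * B lam μ)
    + (1/2) * (∑ τ, (nDown lam * E σ τ - nDown σ * E lam τ) * eps3of4 τ μ ν)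
    + (1/2) * (∑ τ, (nDown μ * E ν τ - nDown ν * E μ τ) * eps3of4 τ lam σ))

/-- The 3+1 decomposition (P_decomp) of `P_{μν} = C*_{λμσν}∇^λρ∇^σρ` with
`∇ρ = P₀ n + P`. -/
theorem stmt7 (E B : Fin 4 → Fin 4 → ℝ)
    (hsymE : ∀ μ ν, E μ ν = E ν μ) (hsymB : ∀ μ ν, B μ ν = B ν μ)
    (hspE : ∀ μ ν, μ = 0 ∨ ν = 0 → E μ ν = 0)
    (hspB : ∀ μ ν, μ = 0 ∨ ν = 0 → B μ ν = 0)
    (htrE : ∑ μ, E μ μ = 0) (htrB : ∑ μ, B μ μ = 0)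
    (P0 : ℝ) (P : Fin 4 → ℝ) (hP : P 0 = 0)
    (v : Fin 4 → ℝ) (hv : ∀ μ, v μ = P0 * nUp μ + P μ)
    (Pd : Fin 4 → ℝ) (hPd : ∀ μ, Pd μ = ∑ ν, eta μ ν * P ν)
    (Et : Fin 4 → ℝ) (hEt : ∀ μ, Et μ = ∑ ν, E μ ν * P ν)
    (Bt : Fin 4 → ℝ) (hBt : ∀ μ, Bt μ = ∑ ν, B μ ν * P ν)
    (γsq : ℝ) (hγsq : γsq = ∑ ν, Pd ν * P ν) :
    ∀ μ ν : Fin 4,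
      (∑ lam, ∑ σ, weylCStar E B lam μ σ ν * v lam * v σ)
        = (P0^2 + γsq) * B μ ν
          + P0 * (nDown μ * Bt ν + nDown ν * Bt μ)
          + P0 * (∑ τ, ∑ lam, (E τ μ * eps3of4 τ ν lam + E τ ν * eps3of4 τ μ lam) * P lam)
          - (Pd μ * Bt ν + Pd ν * Bt μ)
          + lD μ ν * (∑ σ, Bt σ * P σ)
          - (∑ τ, ∑ σ, (nDown μ * Et τ * eps3of4 τ σ ν
              + nDown ν * Et τ * eps3of4 τ σ μ) * P σ) := by
  have trace_free {A : Fin 4 → Fin 4 → ℝ} (hsp : ∀ μ ν, μ = 0 ∨ ν = 0 → A μ ν = 0)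
      (htr : ∑ μ, A μ μ = 0) : A 3 3 = -A 1 1 - A 2 2 := by
    have h0 := hsp 0 0 (Or.inl rfl)
    simp only [Fin.sum_univ_four] at htr
    linarith
  have hE0 (μ) : E 0 μ = 0 := hspE 0 μ (Or.inl rfl)
  have hE0' (μ) : E μ 0 = 0 := hspE μ 0 (Or.inr rfl)
  have hB0 (μ) : B 0 μ = 0 := hspB 0 μ (Or.inl rfl)
  have hB0' (μ) : B μ 0 = 0 := hspB μ 0 (Or.inr rfl)
  have hE33 := trace_free hspE htrE
  have hB33 := trace_free hspB htrB
  intro μ ν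
  fin_cases μ <;> fin_cases ν <;>
    (simp [Fin.sum_univ_four, weylCStar, eps3of4, eps4, lD, eta, dd, nUp, nDown,
      hv, hPd, hEt, hBt, hγsq, hP, hE0, hE0', hB0, hB0', hE33, hB33,
      hsymE 2 1, hsymE 3 1, hsymE 3 2, hsymB 2 1, hsymB 3 1, hsymB 3 2]
     try ring)
end

section
/- In the setting of the 3+1 decomposition of P_{μν} := C*_{λμσν}v^λv^σ (with C* built from symmetric traceless spatial tensors E, B via formula (weyl-2), v = P₀n + P, n = e₀), one has P_{μν} = 0 for all μ, ν if and only if the following three spatial conditions hold: (i) B̃_iP_i = 0 (new_short); (ii) (Ẽ×P)_i = P₀B̃_i for all i (new_wedge); and (iii) (P₀² + γ²)B_{ij} + P₀(N_{ij} + N_{ji}) − (P_iB̃_j + P_jB̃_i) = 0 for all i, j, where N_{ij} := Σ_{k,l} ε_{kjl}E_{ki}P_l (new_bwedge). -/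
/-- The 3+1 decomposition of the contraction `C*_{λμσν} v^λ v^σ` with `v = P₀ n + P`. -/
lemma sum_weylCStar_mul_mul (E B : Fin 4 → Fin 4 → ℝ)
    (hsymE : ∀ μ ν, E μ ν = E ν μ) (hsymB : ∀ μ ν, B μ ν = B ν μ)
    (hspE : ∀ μ ν, μ = 0 ∨ ν = 0 → E μ ν = 0)
    (hspB : ∀ μ ν, μ = 0 ∨ ν = 0 → B μ ν = 0)
    (P0 : ℝ) (P : Fin 4 → ℝ) (hP : P 0 = 0)
    (v : Fin 4 → ℝ) (hv : ∀ μ, v μ = P0 * nUp μ + P μ)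
    (Et : Fin 4 → ℝ) (hEt : ∀ μ, Et μ = ∑ ν, E μ ν * P ν)
    (Bt : Fin 4 → ℝ) (hBt : ∀ μ, Bt μ = ∑ ν, B μ ν * P ν)
    (γsq : ℝ) (hγsq : γsq = ∑ ν, P ν * P ν)
    (N : Fin 4 → Fin 4 → ℝ)
    (hN : ∀ i j, N i j = ∑ k, ∑ l, eps3of4 k j l * E k i * P l) (μ ν : Fin 4) :
    (∑ lam, ∑ σ, weylCStar E B lam μ σ ν * v lam * v σ) =
      ((P0^2 + γsq) * B μ ν + P0 * (N μ ν + N ν μ) - (P μ * Bt ν + P ν * Bt μ))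
      - nDown μ * ((∑ j, ∑ k, eps3of4 ν j k * Et j * P k) - P0 * Bt ν)
      - nDown ν * ((∑ j, ∑ k, eps3of4 μ j k * Et j * P k) - P0 * Bt μ)
      + (if μ = ν then 1 else 0) * ∑ i, Bt i * P i := by
  have E0 : ∀ μ, E 0 μ = 0 := fun μ => hspE 0 μ (Or.inl rfl)
  have E0' : ∀ μ, E μ 0 = 0 := fun μ => hspE μ 0 (Or.inr rfl)
  have B0 : ∀ μ, B 0 μ = 0 := fun μ => hspB 0 μ (Or.inl rfl)
  have B0' : ∀ μ, B μ 0 = 0 := fun μ => hspB μ 0 (Or.inr rfl)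
  have hl : ∀ μ ν, lD μ ν = if μ = ν then 1 else 0 := by
    intro μ ν
    fin_cases μ <;> fin_cases ν <;> norm_num [lD, eta, dd, nDown]
  fin_cases μ <;> fin_cases ν <;>
    simp [Fin.sum_univ_four, weylCStar, hl, nDown, nUp, eps3of4, eps4, hv, hEt, hBt, hγsq, hN,
      hP, E0, E0', B0, B0', hsymE 2 1, hsymE 3 1, hsymE 3 2, hsymB 2 1, hsymB 3 1, hsymB 3 2] <;>
    ring

/-- The 3+1 splitting of the condition `P_{μν} = 0` of the Ferrando–Sáez
characterisation into the conditions (new_short), (new_wedge), (new_bwedge). -/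
theorem stmt8 (E B : Fin 4 → Fin 4 → ℝ)
    (hsymE : ∀ μ ν, E μ ν = E ν μ) (hsymB : ∀ μ ν, B μ ν = B ν μ)
    (hspE : ∀ μ ν, μ = 0 ∨ ν = 0 → E μ ν = 0)
    (hspB : ∀ μ ν, μ = 0 ∨ ν = 0 → B μ ν = 0)
    (htrE : ∑ μ, E μ μ = 0) (htrB : ∑ μ, B μ μ = 0)
    (P0 : ℝ) (P : Fin 4 → ℝ) (hP : P 0 = 0)
    (v : Fin 4 → ℝ) (hv : ∀ μ, v μ = P0 * nUp μ + P μ)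
    (Et : Fin 4 → ℝ) (hEt : ∀ μ, Et μ = ∑ ν, E μ ν * P ν)
    (Bt : Fin 4 → ℝ) (hBt : ∀ μ, Bt μ = ∑ ν, B μ ν * P ν)
    (γsq : ℝ) (hγsq : γsq = ∑ ν, P ν * P ν)
    (N : Fin 4 → Fin 4 → ℝ)
    (hN : ∀ i j, N i j = ∑ k, ∑ l, eps3of4 k j l * E k i * P l) :
    (∀ μ ν : Fin 4, (∑ lam, ∑ σ, weylCStar E B lam μ σ ν * v lam * v σ) = 0)
    ↔ ((∑ i, Bt i * P i) = 0
        ∧ (∀ i, (∑ j, ∑ k, eps3of4 i j k * Et j * P k) = P0 * Bt i)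
        ∧ (∀ i j, (P0^2 + γsq) * B i j + P0 * (N i j + N j i)
            - (P i * Bt j + P j * Bt i) = 0)) := by
  have key := sum_weylCStar_mul_mul E B hsymE hsymB hspE hspB P0 P hP v hv Et hEt Bt hBt
    γsq hγsq N hN
  have hB0 : ∀ ν, B 0 ν = 0 := fun ν => hspB 0 ν (Or.inl rfl)
  have hBt0 : Bt 0 = 0 := by simp [hBt, hB0]
  have hN0 : ∀ ν, N 0 ν = 0 := fun ν => by simp [hN, hspE _ 0 (Or.inr rfl)]
  have hN0' : ∀ ν, N ν 0 = 0 := fun ν => by simp [hN, eps3of4, eps4]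
  have hW0 : (∑ j, ∑ k, eps3of4 0 j k * Et j * P k) = 0 := by simp [eps3of4, eps4]
  constructor
  · intro h
    have hS : (∑ i, Bt i * P i) = 0 := by
      have h0 := key 0 0
      rw [h 0 0, hW0, hB0, hN0, hBt0, hP, if_pos rfl] at h0
      linarith
    have hW : ∀ i, (∑ j, ∑ k, eps3of4 i j k * Et j * P k) = P0 * Bt i := by
      intro i
      have h0 := key 0 i
      rw [h 0 i, hS, hW0, hB0, hN0, hN0', hBt0, hP, show nDown 0 = -1 from if_pos rfl] at h0
      linarith
    refine ⟨hS, hW, fun i j => ?_⟩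
    have hij := key i j
    rw [h i j, hS, hW, hW] at hij
    linarith
  · rintro ⟨hS, hW, hD⟩ μ ν
    rw [key, hS, hW, hW, hD]
    ring
end

section
/- Let E be a real symmetric 3×3 matrix with zero trace and ρ a nonzero real scalar such that E² + ρE = 2ρ²I. Then there exists a unit vector u ∈ ℝ³ such that E = ρ(I − 3uuᵀ); equivalently, E has eigenvalue −2ρ with multiplicity one and eigenvalue ρ with multiplicity two. -/
open Matrix in
/-- A real symmetric idempotent matrix of trace one is the orthogonal projection onto the line
spanned by a unit vector. -/
theorem Matrix.IsSymm.exists_eq_vecMulVec_of_isIdempotentElem {n : Type*} [Fintype n]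
    {P : Matrix n n ℝ} (hsym : P.IsSymm) (hP : IsIdempotentElem P) (htr : P.trace = 1) :
    ∃ u : n → ℝ, u ⬝ᵥ u = 1 ∧ P = vecMulVec u u := by
  obtain ⟨i, hi⟩ : ∃ i, P i i ≠ 0 := by
    by_contra! h
    simp [Matrix.trace, h] at htr
  have hcol (j : n) : P j ⬝ᵥ P i = P j i := by
    conv_rhs => rw [← hP.eq]
    simp only [mul_apply, dotProduct, hsym.apply]
  have hpos : 0 < P i i := by
    refine lt_of_le_of_ne ?_ hi.symm
    rw [← hcol i]
    exact Finset.sum_nonneg fun j _ => mul_self_nonneg _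
  have hsq : Real.sqrt (P i i) ≠ 0 := (Real.sqrt_pos.2 hpos).ne'
  let u : n → ℝ := (Real.sqrt (P i i))⁻¹ • P i
  have hu : u ⬝ᵥ u = 1 := by
    simp only [u, smul_dotProduct, dotProduct_smul, hcol, smul_eq_mul]
    field_simp
    exact (Real.sq_sqrt hpos.le).symm
  have hPu : P *ᵥ u = u := by
    ext j
    change P j ⬝ᵥ u = u j
    simp only [u, dotProduct_smul, Pi.smul_apply, hcol, hsym.apply]
  have huP : u ᵥ* P = u := by
    rw [← mulVec_transpose, hsym.eq, hPu]
  refine ⟨u, hu, sub_eq_zero.1 (trace_conjTranspose_mul_self_eq_zero_iff.1 ?_)⟩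
  have hQ : (P - vecMulVec u u)ᴴ = P - vecMulVec u u := by
    rw [conjTranspose_eq_transpose_of_trivial, transpose_sub, hsym.eq, transpose_vecMulVec]
  have hQQ : (P - vecMulVec u u) * (P - vecMulVec u u) = P - vecMulVec u u := by
    rw [sub_mul, mul_sub, mul_sub, hP.eq, mul_vecMulVec, vecMulVec_mul, hPu, huP,
      vecMulVec_mul_vecMulVec, hu, one_smul]
    simp
  rw [hQ, hQQ, trace_sub, htr, trace_vecMulVec, hu, sub_self]

/-- Canonical form (a-eform): a symmetric traceless `E` with `E² + ρE = 2ρ²I`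
(`ρ ≠ 0`) is of the form `E = ρ(I − 3uuᵀ)` for a unit vector `u`. -/
theorem stmt9 (E : Matrix (Fin 3) (Fin 3) ℝ) (ρ : ℝ) (hρ : ρ ≠ 0)
    (hsym : E.IsSymm) (htr : E.trace = 0)
    (heq : E * E + ρ • E = (2 * ρ^2) • (1 : Matrix (Fin 3) (Fin 3) ℝ)) :
    ∃ u : Fin 3 → ℝ, (∑ i, u i * u i) = 1
      ∧ E = ρ • ((1 : Matrix (Fin 3) (Fin 3) ℝ) - (3 : ℝ) • Matrix.vecMulVec u u) := by
  let P : Matrix (Fin 3) (Fin 3) ℝ := (3 : ℝ)⁻¹ • (1 - ρ⁻¹ • E)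
  have hP : IsIdempotentElem P := by
    have hE : E * E = (2 * ρ ^ 2) • (1 : Matrix (Fin 3) (Fin 3) ℝ) - ρ • E :=
      eq_sub_of_add_eq heq
    simp only [IsIdempotentElem, P, smul_mul_assoc, mul_smul_comm, sub_mul, mul_sub, one_mul,
      mul_one, hE]
    match_scalars <;> field_simp <;> ring
  have hPsym : P.IsSymm := (Matrix.isSymm_one.sub (hsym.smul _)).smul _
  have hPtr : P.trace = 1 := by
    simp [P, Matrix.trace_sub, htr]
  obtain ⟨u, hu, hPu⟩ := hPsym.exists_eq_vecMulVec_of_isIdempotentElem hP hPtr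
  refine ⟨u, hu, ?_⟩
  rw [← hPu]
  simp only [P]
  match_scalars <;> field_simp
  ring
end

section
/- Let ρ ≠ 0 and α > 0 be real numbers, P ∈ ℝ³ with γ := |P| > 0, P₀ ∈ ℝ, and suppose B = 0 and E = ρ(I − 3PPᵀ/γ²). Then: (i) Ẽ := EP = −2ρP and Ω := ⟨P,EP⟩ = −2ργ²; (ii) γ²ρ − Ω = 3ργ²; and (iii) the pair Y := γ/(3ρ√α), Yvec := (P₀/(3ργ√α))·P satisfies the Killing-candidate equations 27αρ³Y² = γ²ρ − Ω and 27αρ³Y·Yvec_i = (P×B̃)_i − P₀Ẽ_i + ρP₀P_i for all i. -/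
open Matrix

/-- The cross product `(u×v)_i = Σ_{j,k} ε_{ijk}u_jv_k`. -/
noncomputable def cross (u v : Fin 3 → ℝ) (i : Fin 3) : ℝ :=
  ∑ j, ∑ k, eps3 i j k * u j * v k

/-- The canonical form (kid_candidate1) of the KID candidate in the purely
electric case: with `B = 0` and `E = ρ(I − 3PPᵀ/γ²)` one has `Ẽ = −2ρP`,
`Ω = −2ργ²`, `γ²ρ − Ω = 3ργ²`, and `Y = γ/(3ρ√α)`, `Yvec = (P₀/(3ργ√α))P`
solve the Killing-candidate equations. -/
theorem stmt11 (ρ α P0 : ℝ) (P : Fin 3 → ℝ) (hρ : ρ ≠ 0) (hα : 0 < α)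
    (γ : ℝ) (hγdef : γ = Real.sqrt (P ⬝ᵥ P)) (hγpos : 0 < γ)
    (E B : Matrix (Fin 3) (Fin 3) ℝ) (hB : B = 0)
    (hE : ∀ i j, E i j = ρ * (h3 i j - 3 * P i * P j / γ^2))
    (Et Bt : Fin 3 → ℝ) (hEt : Et = E *ᵥ P) (hBt : Bt = B *ᵥ P)
    (Ω : ℝ) (hΩ : Ω = P ⬝ᵥ (E *ᵥ P))
    (Y : ℝ) (hY : Y = γ / (3 * ρ * Real.sqrt α))
    (Yv : Fin 3 → ℝ) (hYv : ∀ i, Yv i = (P0 / (3 * ρ * γ * Real.sqrt α)) * P i) :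
    (∀ i, Et i = -2 * ρ * P i) ∧ Ω = -2 * ρ * γ^2
    ∧ γ^2 * ρ - Ω = 3 * ρ * γ^2
    ∧ 27 * α * ρ^3 * Y^2 = γ^2 * ρ - Ω
    ∧ (∀ i, 27 * α * ρ^3 * Y * Yv i = cross P Bt i - P0 * Et i + ρ * P0 * P i) := by
  have hsum : P ⬝ᵥ P = γ ^ 2 := by
    rw [hγdef, Real.sq_sqrt]
    exact Real.sqrt_pos.mp (hγdef ▸ hγpos) |>.le
  have hγ : γ ≠ 0 := hγpos.ne'
  have hEP : E *ᵥ P = (-2 * ρ) • P := by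
    have hEmat : E = ρ • (1 : Matrix (Fin 3) (Fin 3) ℝ) - (3 * ρ / γ ^ 2) • vecMulVec P P := by
      ext i j
      simp only [hE, h3, Matrix.sub_apply, Matrix.smul_apply, one_apply, vecMulVec_apply, smul_eq_mul]
      ring
    ext i
    simp only [hEmat, sub_mulVec, smul_mulVec, one_mulVec, vecMulVec_mulVec, hsum,
      Pi.sub_apply, Pi.smul_apply, smul_eq_mul, MulOpposite.smul_eq_mul_unop,
      MulOpposite.unop_op]
    field_simp
    ring
  have hEti : ∀ i, Et i = -2 * ρ * P i := fun i => by
    simp [hEt, hEP]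
  have hΩ' : Ω = -2 * ρ * γ ^ 2 := by
    rw [hΩ, hEP, dotProduct_smul, hsum, smul_eq_mul]
  have hs : Real.sqrt α ≠ 0 := (Real.sqrt_pos.mpr hα).ne'
  have hsα : Real.sqrt α ^ 2 = α := Real.sq_sqrt hα.le
  refine ⟨hEti, hΩ', by rw [hΩ']; ring, ?_, fun i => ?_⟩
  · rw [hΩ', hY, ← hsα, Real.sqrt_sq (Real.sqrt_nonneg α)]
    field_simp
    ring
  · have hcross : cross P Bt i = 0 := by simp [cross, hBt, hB]
    rw [hcross, hEti, hYv, hY, ← hsα, Real.sqrt_sq (Real.sqrt_nonneg α)]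
    field_simp
    ring
end

section
/- Let E and B be real symmetric 3×3 matrices with zero trace, P₀ ∈ ℝ, P ∈ ℝ³ with γ := |P| > 0, and suppose β := |B̃| > 0 where B̃ := BP; set Ẽ := EP. Assume: (new_short) ⟨B̃,P⟩ = 0; (new_wedge) Ẽ×P = P₀B̃; and (new_bwedge) (P₀²+γ²)B_{ij} + P₀(N_{ij}+N_{ji}) − (P_iB̃_j + P_jB̃_i) = 0 for all i,j, where N_{ij} := Σ_{k,l} ε_{kjl}E_{ki}P_l. Define the orthonormal frame e₁ := P/γ, e₂ := B̃/β, e₃ := (P×B̃)/(γβ). Then: ⟨e₁,Be₁⟩ = 0, ⟨e₁,Be₃⟩ = 0, ⟨e₁,Be₂⟩ = β/γ, ⟨e₁,Ee₂⟩ = 0, ⟨e₁,Ee₃⟩ = P₀β/γ², ⟨e₂,Be₂⟩ = 2γP₀⟨e₂,Ee₃⟩/(P₀²+γ²) = −⟨e₃,Be₃⟩, and ⟨e₂,Be₃⟩ = γP₀(⟨e₃,Ee₃⟩ − ⟨e₂,Ee₂⟩)/(P₀²+γ²). -/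
open Matrix

/-- `N_{ij} := Σ_{k,l} ε_{kjl}E_{ki}P_l`. -/
noncomputable def Nmat (E : Matrix (Fin 3) (Fin 3) ℝ) (P : Fin 3 → ℝ) (i j : Fin 3) : ℝ :=
  ∑ k, ∑ l, eps3 k j l * E k i * P l

theorem eps3_contract (f : Fin 3 → Fin 3 → ℝ) (i : Fin 3) :
    ∑ j, ∑ k, eps3 i j k * f j k
      = f (i + 1) (i + 2) - f (i + 2) (i + 1) := by
  fin_cases i <;> simp [eps3, Fin.sum_univ_three] <;> ring

theorem cross_eq_cyclic (u v : Fin 3 → ℝ) (i : Fin 3) :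
    cross u v i = u (i + 1) * v (i + 2) - u (i + 2) * v (i + 1) := by
  simpa only [cross, mul_assoc] using eps3_contract (fun j k => u j * v k) i

theorem cross_zero (u v : Fin 3 → ℝ) : cross u v 0 = u 1 * v 2 - u 2 * v 1 :=
  cross_eq_cyclic u v 0

theorem cross_one (u v : Fin 3 → ℝ) : cross u v 1 = u 2 * v 0 - u 0 * v 2 :=
  cross_eq_cyclic u v 1

theorem cross_two (u v : Fin 3 → ℝ) : cross u v 2 = u 0 * v 1 - u 1 * v 0 :=
  cross_eq_cyclic u v 2

theorem cross_dotProduct_right (u v : Fin 3 → ℝ) : cross u v ⬝ᵥ v = 0 := by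
  simp only [dotProduct, Fin.sum_univ_three, cross_zero, cross_one, cross_two]
  ring

theorem cross_dotProduct_left (u v : Fin 3 → ℝ) : cross u v ⬝ᵥ u = 0 := by
  simp only [dotProduct, Fin.sum_univ_three, cross_zero, cross_one, cross_two]
  ring

theorem cross_swap (u v : Fin 3 → ℝ) : cross u v = -cross v u := by
  ext i
  simp only [cross_eq_cyclic, Pi.neg_apply]
  ring

theorem dotProduct_cross_comm (u v w : Fin 3 → ℝ) : u ⬝ᵥ cross v w = cross u v ⬝ᵥ w := by
  simp only [dotProduct, Fin.sum_univ_three, cross_zero, cross_one, cross_two]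
  ring

theorem cross_cross_left (u v : Fin 3 → ℝ) :
    cross (cross u v) u = (u ⬝ᵥ u) • v - (u ⬝ᵥ v) • u := by
  ext i
  fin_cases i <;>
  · simp [dotProduct, Fin.sum_univ_three, cross_zero, cross_one, cross_two]
    ring

theorem dotProduct_Nmat_mulVec (E : Matrix (Fin 3) (Fin 3) ℝ) (P u v : Fin 3 → ℝ) :
    ∑ i, ∑ j, u i * Nmat E P i j * v j = (E *ᵥ u) ⬝ᵥ cross v P := by
  simp only [Nmat, cross, mulVec, dotProduct, Finset.mul_sum, Finset.sum_mul]
  simp only [Fin.sum_univ_three]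
  ring

theorem Matrix.IsSymm.dotProduct_mulVec_comm {A : Matrix (Fin 3) (Fin 3) ℝ} (hA : A.IsSymm)
    (u v : Fin 3 → ℝ) : u ⬝ᵥ (A *ᵥ v) = v ⬝ᵥ (A *ᵥ u) := by
  rw [dotProduct_mulVec, ← mulVec_transpose, hA.eq, dotProduct_comm]

/-- The frame relations of the most general case (`B̃ ≠ 0`) of the algebraic
classification of Schwarzschild initial data, expressing the frame components
of `B` in terms of those of `E` in the orthonormal frame
`e₁ = P/γ`, `e₂ = B̃/β`, `e₃ = (P×B̃)/(γβ)`. -/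
theorem stmt12 (E B : Matrix (Fin 3) (Fin 3) ℝ) (P0 : ℝ) (P : Fin 3 → ℝ)
    (hsymE : E.IsSymm) (hsymB : B.IsSymm)
    (htrE : E.trace = 0) (htrB : B.trace = 0)
    (Et Bt : Fin 3 → ℝ) (hEt : Et = E *ᵥ P) (hBt : Bt = B *ᵥ P)
    (γ : ℝ) (hγdef : γ = Real.sqrt (P ⬝ᵥ P)) (hγpos : 0 < γ)
    (β : ℝ) (hβdef : β = Real.sqrt (Bt ⬝ᵥ Bt)) (hβpos : 0 < β)
    (new_short : Bt ⬝ᵥ P = 0)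
    (new_wedge : ∀ i, cross Et P i = P0 * Bt i)
    (new_bwedge : ∀ i j, (P0^2 + γ^2) * B i j + P0 * (Nmat E P i j + Nmat E P j i)
      - (P i * Bt j + P j * Bt i) = 0)
    (e1 e2 e3 : Fin 3 → ℝ)
    (he1 : e1 = γ⁻¹ • P) (he2 : e2 = β⁻¹ • Bt) (he3 : e3 = (γ * β)⁻¹ • cross P Bt) :
    e1 ⬝ᵥ (B *ᵥ e1) = 0
    ∧ e1 ⬝ᵥ (B *ᵥ e3) = 0
    ∧ e1 ⬝ᵥ (B *ᵥ e2) = β / γ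
    ∧ e1 ⬝ᵥ (E *ᵥ e2) = 0
    ∧ e1 ⬝ᵥ (E *ᵥ e3) = P0 * β / γ^2
    ∧ e2 ⬝ᵥ (B *ᵥ e2) = 2 * γ * P0 * (e2 ⬝ᵥ (E *ᵥ e3)) / (P0^2 + γ^2)
    ∧ e2 ⬝ᵥ (B *ᵥ e2) = -(e3 ⬝ᵥ (B *ᵥ e3))
    ∧ e2 ⬝ᵥ (B *ᵥ e3) = γ * P0 * ((e3 ⬝ᵥ (E *ᵥ e3)) - (e2 ⬝ᵥ (E *ᵥ e2))) / (P0^2 + γ^2) := by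
  have bil : ∀ u v : Fin 3 → ℝ, (P0 ^ 2 + γ ^ 2) * (u ⬝ᵥ (B *ᵥ v))
      + P0 * ((E *ᵥ u) ⬝ᵥ cross v P + (E *ᵥ v) ⬝ᵥ cross u P)
      - ((u ⬝ᵥ P) * (v ⬝ᵥ Bt) + (v ⬝ᵥ P) * (u ⬝ᵥ Bt)) = 0 := by
    intro u v
    have h : ∑ i, ∑ j, u i * v j * ((P0 ^ 2 + γ ^ 2) * B i j
        + P0 * (Nmat E P i j + Nmat E P j i) - (P i * Bt j + P j * Bt i)) = 0 := by
      simp only [new_bwedge, mul_zero, Finset.sum_const_zero]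
    rw [← h, ← dotProduct_Nmat_mulVec, ← dotProduct_Nmat_mulVec]
    simp only [dotProduct, mulVec, Fin.sum_univ_three]
    ring
  have hg : P ⬝ᵥ P = γ ^ 2 := by
    rw [hγdef, Real.sq_sqrt (by simpa using dotProduct_star_self_nonneg P)]
  have hb : Bt ⬝ᵥ Bt = β ^ 2 := by
    rw [hβdef, Real.sq_sqrt (by simpa using dotProduct_star_self_nonneg Bt)]
  have short' : P ⬝ᵥ Bt = 0 := by rw [dotProduct_comm, new_short]
  have wedge : cross Et P = P0 • Bt := funext fun i => by simp [new_wedge]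
  set W := cross P Bt with hW
  have hWP : W ⬝ᵥ P = 0 := cross_dotProduct_left P Bt
  have hWB : W ⬝ᵥ Bt = 0 := cross_dotProduct_right P Bt
  have hBP : cross Bt P = -W := cross_swap Bt P
  have hWxP : cross W P = γ ^ 2 • Bt := by
    rw [hW, cross_cross_left, hg, short', zero_smul, sub_zero]
  have hPBP : P ⬝ᵥ (B *ᵥ P) = 0 := by rw [← hBt, short']
  have hPBW : P ⬝ᵥ (B *ᵥ W) = 0 := by
    rw [hsymB.dotProduct_mulVec_comm, ← hBt, hWB]
  have hPBB : P ⬝ᵥ (B *ᵥ Bt) = β ^ 2 := by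
    rw [hsymB.dotProduct_mulVec_comm, ← hBt, hb]
  have hPEW : P ⬝ᵥ (E *ᵥ W) = P0 * β ^ 2 := by
    rw [hsymE.dotProduct_mulVec_comm, ← hEt, dotProduct_comm, hW, dotProduct_cross_comm,
      wedge, smul_dotProduct, hb, smul_eq_mul]
  have hPEB : P ⬝ᵥ (E *ᵥ Bt) = 0 := by
    have h : γ ^ 2 * (Et ⬝ᵥ Bt) = 0 := by
      rw [← smul_eq_mul, ← dotProduct_smul, ← hWxP, cross_swap W P, dotProduct_neg,
        dotProduct_cross_comm, wedge, smul_dotProduct, dotProduct_comm, hWB]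
      simp
    rw [hsymE.dotProduct_mulVec_comm, ← hEt, dotProduct_comm]
    exact (mul_eq_zero.mp h).resolve_left (by positivity)
  have hBB := bil Bt Bt
  have hBW := bil Bt W
  have hWW := bil W W
  simp only [hBP, hWxP, hWP, hWB, new_short, neg_dotProduct, smul_dotProduct, smul_eq_mul,
    dotProduct_comm (E *ᵥ _)] at hBB hBW hWW
  rw [hsymE.dotProduct_mulVec_comm W Bt] at hBB
  have hs : P0 ^ 2 + γ ^ 2 ≠ 0 := by positivity
  subst he1 he2 he3
  simp only [mulVec_smul, dotProduct_smul, smul_dotProduct, smul_eq_mul, hPBP, hPBW, hPBB,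
    hPEW, hPEB, mul_zero, true_and]
  refine ⟨?_, ?_, ?_, ?_, ?_⟩
  · field_simp
  · field_simp
  · field_simp
    linear_combination hBB
  · field_simp
    apply mul_left_cancel₀ hs
    linear_combination γ ^ 2 * hBB + hWW
  · field_simp
    linear_combination hBW
end
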